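/- arXiv:2505.14021 — 2 statements merged into one kernel-verified Lean document; each statement's English description precedes it below -/
import Mathlib

section
/- Fix matrices P_in ∈ ℝ^{N×d}, W^(l), P^(l) ∈ ℝ^{N×N} and vectors b^(l) ∈ ℝ^N for l = 1,…,L, and an input x ∈ ℝ^d. Define x^(0) := P_in x and, for l = 1,…,L, h^(l) := W^(l) x^(l−1) + b^(l) and x^(l) := x^(l−1) + P^(l) φ(h^(l)), where φ is applied entrywise. Define U^(l) := P^(l) D(φ₀(h^(l))) W^(l), d^(l) := P^(l) D(φ₀(h^(l))) b^(l), V^(0) := 0, c^(0) := 0, V^(l) := U^(l) + V^(l−1) + U^(l) V^(l−1), and c^(l) := c^(l−1) + U^(l) c^(l−1) + d^(l), where D(y) is the diagonal matrix with diagonal y and φ₀ is applied entrywise. Then for every l = 0,1,…,L one has x^(l) = (I + V^(l)) x^(0) + c^(l). -/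
open Matrix

/-- Exact linear-like representation of a residual ReLU-like network:
with `U^(l)`, `d^(l)`, `V^(l)`, `c^(l)` defined by the stated recursions, every
post-activation satisfies `x^(l) = (I + V^(l)) x^(0) + c^(l)` for `l = 0, 1, …, L`. -/
theorem stmt2 (N d L : ℕ)
    (u v : ℝ)
    (φ : ℝ → ℝ) (hφ : ∀ z : ℝ, φ z = if 0 ≤ z then u * z else v * z)
    (φ₀ : ℝ → ℝ) (hφ₀ : ∀ z : ℝ, φ₀ z = if 0 ≤ z then u else v)
    (Pin : Matrix (Fin N) (Fin d) ℝ)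
    (W P : ℕ → Matrix (Fin N) (Fin N) ℝ) (b : ℕ → Fin N → ℝ)
    (x : Fin d → ℝ)
    (X : ℕ → Fin N → ℝ) (hX0 : X 0 = Pin.mulVec x)
    (h : ℕ → Fin N → ℝ)
    (hh : ∀ l, 1 ≤ l → l ≤ L → h l = (W l).mulVec (X (l - 1)) + b l)
    (hX : ∀ l, 1 ≤ l → l ≤ L → X l = X (l - 1) + (P l).mulVec (fun i => φ (h l i)))
    (U : ℕ → Matrix (Fin N) (Fin N) ℝ) (dv : ℕ → Fin N → ℝ)
    (hU : ∀ l, 1 ≤ l → l ≤ L →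
      U l = P l * Matrix.diagonal (fun i => φ₀ (h l i)) * W l)
    (hdv : ∀ l, 1 ≤ l → l ≤ L →
      dv l = (P l * Matrix.diagonal (fun i => φ₀ (h l i))).mulVec (b l))
    (V : ℕ → Matrix (Fin N) (Fin N) ℝ) (c : ℕ → Fin N → ℝ)
    (hV0 : V 0 = 0) (hc0 : c 0 = 0)
    (hV : ∀ l, 1 ≤ l → l ≤ L → V l = U l + V (l - 1) + U l * V (l - 1))
    (hc : ∀ l, 1 ≤ l → l ≤ L → c l = c (l - 1) + (U l).mulVec (c (l - 1)) + dv l) :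
    ∀ l ≤ L, X l = (1 + V l).mulVec (X 0) + c l := by
  have slope_mul (z : ℝ) : φ z = φ₀ z * z := by
    rw [hφ, hφ₀]
    split_ifs <;> rfl
  intro l
  induction l with
  | zero => intro _; simp [hV0, hc0]
  | succ k ih =>
    intro hk
    have hpos : 1 ≤ k + 1 := Nat.le_add_left 1 k
    have activation : (fun i => φ (h (k + 1) i)) =
        diagonal (fun i => φ₀ (h (k + 1) i)) *ᵥ h (k + 1) := by
      ext i
      rw [mulVec_diagonal, slope_mul]
    have block : X (k + 1) = X k + U (k + 1) *ᵥ X k + dv (k + 1) := by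
      rw [hX _ hpos hk, activation, mulVec_mulVec, hU _ hpos hk, hdv _ hpos hk,
        ← mulVec_mulVec _ _ (W (k + 1)), add_assoc, ← mulVec_add, Nat.add_sub_cancel]
      congr 2
      simpa using hh _ hpos hk
    rw [block, ih (Nat.le_of_succ_le hk), hV _ hpos hk, hc _ hpos hk, Nat.add_sub_cancel]
    simp only [add_mulVec, mulVec_add, one_mulVec, ← mulVec_mulVec]
    abel
end

section
/- Let a > 0, k ≥ 0, r ≥ 0, x₀ > 0, and T > 0. Suppose x : [0, T] → ℝ is differentiable with x(0) = x₀ and x′(t) = −a·(1 + k·x(t))^r · x(t) for all t ∈ [0, T]. Then 0 < x(t) ≤ x₀ for all t ∈ [0, T] and x is nonincreasing on [0, T]. Consequently, for any α > 0, M ≥ 1 and integer L ≥ 1 with α·x₀ ≤ M^{1/L} − 1, one has α·x(t) ≤ M^{1/L} − 1 for all t ∈ [0, T]. -/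
/-- A solution of a linear equation `x' = c x` on `[a, b]` whose coefficient is bounded below
stays positive if it starts positive. -/
theorem pos_of_hasDerivWithinAt_mul_self {x c : ℝ → ℝ} {a b C : ℝ}
    (hx : ∀ t ∈ Set.Icc a b, HasDerivWithinAt x (c t * x t) (Set.Icc a b) t)
    (hc : ∀ t ∈ Set.Icc a b, -C ≤ c t) (ha : 0 < x a) :
    ∀ t ∈ Set.Icc a b, 0 < x t := by
  have hcont : ContinuousOn x (Set.Icc a b) := fun t ht => (hx t ht).continuousWithinAt
  have hd : ∀ t ∈ Set.Icc a b, HasDerivWithinAt (fun s => x s ^ 2 * Real.exp (2 * C * s))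
      (2 * (x t ^ 2 * Real.exp (2 * C * t)) * (c t + C)) (Set.Icc a b) t := by
    intro t ht
    have he : HasDerivAt (fun s => Real.exp (2 * C * s)) (Real.exp (2 * C * t) * (2 * C)) t := by
      simpa using ((hasDerivAt_id t).const_mul (2 * C)).exp
    refine (((hx t ht).fun_pow 2).fun_mul he.hasDerivWithinAt).congr_deriv ?_
    push_cast
    ring
  have hmono : MonotoneOn (fun s => x s ^ 2 * Real.exp (2 * C * s)) (Set.Icc a b) := by
    refine monotoneOn_of_hasDerivWithinAt_nonneg (convex_Icc a b)
      (fun t ht => (hd t ht).continuousWithinAt)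
      (fun t ht => (hd t (interior_subset ht)).mono interior_subset) fun t ht => ?_
    have := hc t (interior_subset ht)
    exact mul_nonneg (by positivity) (by linarith)
  have hne : ∀ t ∈ Set.Icc a b, x t ≠ 0 := by
    intro t ht h0
    have h := hmono (Set.left_mem_Icc.2 (ht.1.trans ht.2)) ht ht.1
    have hpos : 0 < x a ^ 2 * Real.exp (2 * C * a) := by positivity
    simp only [h0] at h
    linarith
  intro t ht
  by_contra! hneg
  obtain ⟨s, hs, hs0⟩ := intermediate_value_Icc' ht.1
    (hcont.mono (Set.Icc_subset_Icc_right ht.2)) ⟨hneg, ha.le⟩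
  exact hne s ⟨hs.1, hs.2.trans ht.2⟩ hs0

/-- If `x' = −a(1 + k x)^r x` on `[0, T]` with `a > 0`, `k ≥ 0`, `r ≥ 0`,
`x(0) = x₀ > 0`, then `0 < x(t) ≤ x₀` on `[0, T]` and `x` is nonincreasing there;
consequently, the residual trainability condition `α x ≤ M^{1/L} − 1` is preserved: if
`α x₀ ≤ M^{1/L} − 1` then `α x(t) ≤ M^{1/L} − 1` for all `t ∈ [0, T]`. -/
theorem stmt13 (a k r x₀ T : ℝ) (ha : 0 < a) (hk : 0 ≤ k) (hr : 0 ≤ r)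
    (hx₀ : 0 < x₀) (hT : 0 < T)
    (x : ℝ → ℝ) (hx0 : x 0 = x₀)
    (hderiv : ∀ t ∈ Set.Icc (0 : ℝ) T,
      HasDerivWithinAt x (-a * (1 + k * x t) ^ r * x t) (Set.Icc (0 : ℝ) T) t) :
    (∀ t ∈ Set.Icc (0 : ℝ) T, 0 < x t ∧ x t ≤ x₀) ∧
    AntitoneOn x (Set.Icc (0 : ℝ) T) ∧
    ∀ (α M : ℝ) (L : ℕ), 0 < α → 1 ≤ M → 1 ≤ L →
      α * x₀ ≤ M ^ (1 / (L : ℝ)) - 1 →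
      ∀ t ∈ Set.Icc (0 : ℝ) T, α * x t ≤ M ^ (1 / (L : ℝ)) - 1 := by
  have hcont : ContinuousOn x (Set.Icc 0 T) := fun t ht => (hderiv t ht).continuousWithinAt
  have hcoeff : ContinuousOn (fun t => a * (1 + k * x t) ^ r) (Set.Icc 0 T) :=
    continuousOn_const.mul ((continuousOn_const.add (continuousOn_const.mul hcont)).rpow_const
      fun _ _ => Or.inr hr)
  obtain ⟨C, hC⟩ := isCompact_Icc.bddAbove_image hcoeff
  have hpos : ∀ t ∈ Set.Icc (0 : ℝ) T, 0 < x t := by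
    refine pos_of_hasDerivWithinAt_mul_self (C := C) hderiv (fun t ht => ?_) (hx0 ▸ hx₀)
    have := hC (Set.mem_image_of_mem _ ht)
    linarith
  have hanti : AntitoneOn x (Set.Icc 0 T) := by
    refine antitoneOn_of_hasDerivWithinAt_nonpos (convex_Icc 0 T) hcont
      (fun t ht => (hderiv t (interior_subset ht)).mono interior_subset) fun t ht => ?_
    have hxt := hpos t (interior_subset ht)
    have : 0 ≤ a * (1 + k * x t) ^ r * x t := by positivity
    linarith
  have hle : ∀ t ∈ Set.Icc (0 : ℝ) T, x t ≤ x₀ := fun t ht =>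
    hx0 ▸ hanti (Set.left_mem_Icc.2 hT.le) ht ht.1
  exact ⟨fun t ht => ⟨hpos t ht, hle t ht⟩, hanti, fun α M L hα _ _ h t ht =>
    (mul_le_mul_of_nonneg_left (hle t ht) hα.le).trans h⟩
end
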